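/- Let p be a prime, q = p^m a power of p, n ≥ 1, and let L(X) = Σ_{i=0}^{n-1} a_i X^{q^i} with a_i ∈ F_{q^n} and (a_1, …, a_{n−1}) ≠ (0, …, 0). Assume Tr_{q^n/q}(L(x)/x) ≠ 0 for every nonzero x ∈ F_{q^n}, and assume Tr_{q^n/q}(a_0) = 0. Then for every integer 1 ≤ j ≤ q^n−2 with gcd(j, q^n−1) = 1, there exists an index i with 1 ≤ i ≤ n−1 such that a_i ≠ 0 and Lead(Res(j(q^i−1))) ≥ 1 + ⌈ 2(q^n−q) / ((q−1)·⌊2q^{n/2}⌋) ⌉. -/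

import Mathlib

/-- `leadFn p N j` is the smallest nonnegative integer in the `p`-cyclotomic coset of
`j` modulo `N`, i.e. the smallest `k` with `k ≡ j·p^u (mod N)` for some `u ≥ 0`. -/
noncomputable def leadFn (p N j : ℕ) : ℕ := sInf {k : ℕ | ∃ u : ℕ, k % N = j * p ^ u % N}


lemma sum_zmod {n : ℕ} [NeZero n] {R : Type*} [AddCommMonoid R] (f : ZMod n → R) :
    ∑ b, f b = ∑ i ∈ Finset.range n, f (i : ZMod n) := by
  symm
  refine Finset.sum_bij' (fun (i : ℕ) _ => (i : ZMod n)) (fun (b : ZMod n) _ => b.val) ?_ ?_ ?_ ?_ ?_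
  · simp
  · intro b _; exact Finset.mem_range.2 (ZMod.val_lt b)
  · intro i hi; exact ZMod.val_cast_of_lt (Finset.mem_range.1 hi)
  · intro b _; exact ZMod.natCast_zmod_val b
  · intro i hi; rfl

lemma carry {n : ℕ} [NeZero n] (q : ℤ) (g : ZMod n → ℤ)
    (h : (q ^ n - 1) ∣ ∑ b, g b * q ^ b.val) : ∃ u : ZMod n → ℤ, ∀ b, g b = q * u b - u (b - 1) := by
  obtain ⟨T, hT⟩ := h
  have hn : 0 < n := Nat.pos_of_ne_zero (NeZero.ne n)
  let V : ℕ → ℤ := fun j => Nat.rec T (fun j v => q * v - g ((n - 1 - j : ℕ) : ZMod n)) j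
  have V0 : V 0 = T := rfl
  have Vs : ∀ j, V (j + 1) = q * V j - g ((n - 1 - j : ℕ) : ZMod n) := fun j => rfl
  have hV : ∀ j, j ≤ n → V j = q ^ j * T - ∑ i ∈ Finset.range j, g ((n - 1 - i : ℕ) : ZMod n) * q ^ (j - 1 - i) := by
    intro j
    induction j with
    | zero => intro _; simp [V0]
    | succ j ih =>
      intro hj
      rw [Vs, ih (by omega), Finset.sum_range_succ, mul_sub, Finset.mul_sum]
      have : ∀ i ∈ Finset.range j, q * (g ((n - 1 - i : ℕ) : ZMod n) * q ^ (j - 1 - i)) =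
          g ((n - 1 - i : ℕ) : ZMod n) * q ^ (j + 1 - 1 - i) := by
        intro i hi
        rw [Finset.mem_range] at hi
        rw [show j + 1 - 1 - i = (j - 1 - i) + 1 by omega, pow_succ]; ring
      rw [Finset.sum_congr rfl this]
      simp only [Nat.add_sub_cancel, Nat.sub_self, pow_zero, mul_one]
      ring
  have hsum : ∑ b, g b * q ^ b.val = ∑ i ∈ Finset.range n, g (i : ZMod n) * q ^ i := by
    rw [sum_zmod]
    refine Finset.sum_congr rfl fun i hi => ?_
    rw [ZMod.val_cast_of_lt (Finset.mem_range.1 hi)]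
  have Vn : V n = T := by
    rw [hV n le_rfl, Finset.sum_range_reflect (fun i => g (i : ZMod n) * q ^ i) n, ← hsum, hT]; ring
  refine ⟨fun b => V (n - 1 - b.val), fun b => ?_⟩
  have hb := ZMod.val_lt b
  have e1 := Vs (n - 1 - b.val)
  rw [show n - 1 - (n - 1 - b.val) = b.val by omega, ZMod.natCast_zmod_val] at e1
  have e2 : V (n - 1 - (b - 1).val) = V (n - 1 - b.val + 1) := by
    by_cases h0 : b.val = 0
    · have : b = 0 := (ZMod.val_eq_zero b).1 h0
      rw [h0, Nat.sub_zero, show n - 1 + 1 = n by omega, Vn]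
      have : (b - 1).val = n - 1 := by
        subst this
        rw [zero_sub, show (-1 : ZMod n) = ((n - 1 : ℕ) : ZMod n) by
          rw [Nat.cast_sub hn]; simp]
        exact ZMod.val_cast_of_lt (by omega)
      rw [this, Nat.sub_self, V0]
    · have : (b - 1).val = b.val - 1 := by
        rw [show b - 1 = ((b.val - 1 : ℕ) : ZMod n) by
          rw [Nat.cast_sub (by omega), ZMod.natCast_zmod_val]; simp]
        exact ZMod.val_cast_of_lt (by omega)
      rw [this, show n - 1 - (b.val - 1) = n - 1 - b.val + 1 by omega]
  change g b = q * V (n - 1 - b.val) - V (n - 1 - (b - 1).val)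
  rw [e2, e1]; ring

lemma sumz {E : Type*} [Field E] [Fintype E] [DecidableEq E] (k : ℤ) :
    ∑ x : Eˣ, (x : E) ^ k = if ((Fintype.card E : ℤ) - 1) ∣ k then -1 else 0 := by
  have hc : 1 < Fintype.card E := Fintype.one_lt_card
  have hN : (0 : ℤ) < (Fintype.card E : ℤ) - 1 := by omega
  have hN' : ((Fintype.card E : ℤ) - 1) = ((Fintype.card E - 1 : ℕ) : ℤ) := by omega
  set N := (Fintype.card E : ℤ) - 1 with hNd
  have hr := Int.emod_nonneg k hN.ne'
  have h1 : ∀ x : Eˣ, (x : E) ^ k = ((x ^ (k % N).toNat : Eˣ) : E) := by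
    intro x
    have : (x : E) ^ k = (x : E) ^ (N * (k / N) + k % N) := by rw [Int.mul_ediv_add_emod]
    rw [this, zpow_add₀ x.ne_zero, zpow_mul, hN', zpow_natCast,
      FiniteField.pow_card_sub_one_eq_one _ x.ne_zero, one_zpow, one_mul, ← hN']
    obtain ⟨r, hr'⟩ := Int.eq_ofNat_of_zero_le hr
    rw [hr']; simp
  rw [Finset.sum_congr rfl (fun x _ => h1 x)]
  have := FiniteField.sum_pow_units E (k % N).toNat
  push_cast at this ⊢
  rw [this]
  congr 1
  rw [eq_iff_iff, ← Int.natCast_dvd_natCast, Int.toNat_of_nonneg hr, ← hN']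
  exact (Int.dvd_iff_emod_eq_zero ).trans (by rw [Int.emod_emod_of_dvd _ dvd_rfl]; exact Int.dvd_iff_emod_eq_zero.symm)

lemma expand_contra {E : Type*} [Field E] [Fintype E] {ι : Type*} [Fintype ι] [DecidableEq ι]
    (A : ι → E) (w : ι → ℤ) (d : ℕ) (cv : ℤ)
    (hF : ∀ x : Eˣ, (∑ e, A e * (x : E) ^ w e) ^ d = 1)
    (hcv : ¬ ((Fintype.card E : ℤ) - 1) ∣ cv) (M0 : ι → ℕ) (hM0 : ∑ e, M0 e = d)
    (hdv : ((Fintype.card E : ℤ) - 1) ∣ (∑ e, (M0 e : ℤ) * w e) - cv)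
    (huniq : ∀ M : ι → ℕ, ∑ e, M e = d → (∀ e, A e = 0 → M e = 0) →
      ((Fintype.card E : ℤ) - 1) ∣ (∑ e, (M e : ℤ) * w e) - cv → M = M0) :
    (Nat.multinomial Finset.univ M0 : E) * ∏ e, A e ^ M0 e = 0 := by
  classical
  have h1 : ∑ x : Eˣ, (∑ e, A e * (x : E) ^ w e) ^ d * (x : E) ^ (-cv) = 0 := by
    simp only [hF, one_mul]
    rw [sumz, if_neg (by rwa [dvd_neg])]
  have h2 : ∀ x : Eˣ, (∑ e, A e * (x : E) ^ w e) ^ d * (x : E) ^ (-cv) =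
      ∑ M ∈ Finset.univ.piAntidiag d, ((Nat.multinomial Finset.univ M : E) * ∏ e, A e ^ M e) *
        (x : E) ^ ((∑ e, (M e : ℤ) * w e) - cv) := by
    intro x
    rw [Finset.sum_pow_eq_sum_piAntidiag, Finset.sum_mul]
    refine Finset.sum_congr rfl fun M _ => ?_
    rw [sub_eq_add_neg, zpow_add₀ x.ne_zero]
    have : ∏ e, (A e * (x : E) ^ w e) ^ M e = (∏ e, A e ^ M e) * (x : E) ^ (∑ e, (M e : ℤ) * w e) := by
      simp only [mul_pow, Finset.prod_mul_distrib]
      congr 1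
      have : ∀ s : Finset ι, (x : E) ^ (∑ e ∈ s, (M e : ℤ) * w e) = ∏ e ∈ s, ((x : E) ^ w e) ^ M e := by
        intro s
        induction s using Finset.induction_on with
        | empty => simp
        | insert e s he ih =>
          rw [Finset.sum_insert he, Finset.prod_insert he, zpow_add₀ x.ne_zero, ih, mul_comm (M e : ℤ),
            zpow_mul, zpow_natCast]
      rw [this]
    rw [this]; ring
  rw [Finset.sum_congr rfl (fun x _ => h2 x), Finset.sum_comm] at h1
  simp only [← Finset.mul_sum, sumz] at h1
  rw [Finset.sum_eq_single M0] at h1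
  · rw [if_pos hdv] at h1
    simpa using h1
  · intro M hM hne
    rw [Finset.mem_piAntidiag] at hM
    by_cases hz : ∀ e, A e = 0 → M e = 0
    · rw [if_neg fun hd => hne (huniq M hM.1 hz hd), mul_zero]
    · push Not at hz
      obtain ⟨e, he, hme⟩ := hz
      rw [Finset.prod_eq_zero (Finset.mem_univ e) (by rw [he, zero_pow hme])]; simp
  · intro hM
    exact absurd (Finset.mem_piAntidiag.2 ⟨hM0, fun _ _ => Finset.mem_univ _⟩) hM

def coefA {E : Type*} [Field E] {n : ℕ} [NeZero n] (q : ℕ) (a : ℕ → E) (e : ZMod n × ZMod n) : E :=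
  if e.1 = e.2 then 0 else (a (e.1 - e.2).val) ^ q ^ e.2.val

lemma pow_qmod {E : Type*} [Field E] [Fintype E] {q n : ℕ} (hE : Fintype.card E = q ^ n) (x : E) (t : ℕ) :
    x ^ q ^ t = x ^ q ^ (t % n) := by
  conv_lhs => rw [← Nat.div_add_mod t n, pow_add, pow_mul q, pow_mul, ← hE, FiniteField.pow_card_pow]

lemma trace_expand {E : Type*} [Field E] [Fintype E] (p m q n : ℕ) [Fact p.Prime] [CharP E p]
    (hq : q = p ^ m) [NeZero n] (hE : Fintype.card E = q ^ n) (a : ℕ → E)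
    (hTr : ∑ j ∈ Finset.range n, (a 0) ^ q ^ j = 0) (x : Eˣ) :
    ∑ j ∈ Finset.range n, ((∑ i ∈ Finset.range n, a i * (x : E) ^ q ^ i) / (x : E)) ^ q ^ j =
      ∑ e : ZMod n × ZMod n, coefA q a e * (x : E) ^ ((q : ℤ) ^ e.1.val - (q : ℤ) ^ e.2.val) := by
  classical
  have hx : (x : E) ≠ 0 := x.ne_zero
  let Z : ZMod n → ZMod n → E := fun k i =>
    a i.val ^ q ^ k.val * (x : E) ^ ((q : ℤ) ^ (i + k).val - (q : ℤ) ^ k.val)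
  have hL : ∑ j ∈ Finset.range n, ((∑ i ∈ Finset.range n, a i * (x : E) ^ q ^ i) / (x : E)) ^ q ^ j =
      ∑ k : ZMod n, ∑ i : ZMod n, Z k i := by
    rw [sum_zmod]
    refine Finset.sum_congr rfl fun j hj => ?_
    rw [sum_zmod, Finset.sum_div]
    have hqj : q ^ j = p ^ (m * j) := by rw [hq, pow_mul]
    rw [hqj, sum_pow_char_pow, ← hqj]
    refine Finset.sum_congr rfl fun i hi => ?_
    rw [Finset.mem_range] at hi hj
    simp only [Z]
    rw [ZMod.val_add, ZMod.val_cast_of_lt hi, ZMod.val_cast_of_lt hj, zpow_sub₀ hx, div_pow, mul_pow,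
      ← pow_mul, ← pow_add, pow_qmod hE (x : E) (i + j), mul_div_assoc]
    norm_cast
  have hR : ∑ e : ZMod n × ZMod n, coefA q a e * (x : E) ^ ((q : ℤ) ^ e.1.val - (q : ℤ) ^ e.2.val) =
      ∑ k : ZMod n, ∑ i : ZMod n, (if i = 0 then 0 else Z k i) := by
    rw [Fintype.sum_prod_type, Finset.sum_comm]
    refine Finset.sum_congr rfl fun k _ => ?_
    rw [← Equiv.sum_comp (Equiv.addRight k)]
    refine Finset.sum_congr rfl fun i _ => ?_
    simp only [coefA, Equiv.coe_addRight, Z, add_eq_right, add_sub_cancel_right]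
    split_ifs <;> simp
  rw [hL, hR]
  have hz : ∀ k, Z k 0 = a 0 ^ q ^ k.val := by intro k; simp [Z]
  have h0 : ∑ k, Z k 0 = 0 := by
    simp only [hz]; rw [sum_zmod, ← hTr]
    refine Finset.sum_congr rfl fun j hj => ?_
    rw [ZMod.val_cast_of_lt (Finset.mem_range.1 hj)]
  have : ∀ k, ∑ i, Z k i = Z k 0 + ∑ i, (if i = 0 then 0 else Z k i) := by
    intro k
    have : ∀ i, Z k i = (if i = 0 then Z k 0 else 0) + (if i = 0 then 0 else Z k i) := by
      intro i; split_ifs with h <;> simp [h]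
    rw [Finset.sum_congr rfl (fun i _ => this i), Finset.sum_add_distrib]
    simp
  rw [Finset.sum_congr rfl (fun k _ => this k), Finset.sum_add_distrib, h0, zero_add]

lemma trace_pow {E : Type*} [Field E] [Fintype E] (p m q n : ℕ) [Fact p.Prime] [CharP E p]
    (hq : q = p ^ m) [NeZero n] (hE : Fintype.card E = q ^ n) (y : E)
    (hy : ∑ j ∈ Finset.range n, y ^ q ^ j ≠ 0) : (∑ j ∈ Finset.range n, y ^ q ^ j) ^ (q - 1) = 1 := by
  have hqpos : 0 < q := hq ▸ pow_pos (Nat.Prime.pos Fact.out) _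
  apply mul_right_cancel₀ hy
  rw [← pow_succ, Nat.sub_add_cancel hqpos, one_mul]
  have key : ∀ f : ℕ → E, (∑ j ∈ Finset.range n, f j) ^ q = ∑ j ∈ Finset.range n, f j ^ q := by
    intro f; rw [hq]; exact sum_pow_char_pow _ _ _ _
  rw [key]
  have h1 : ∀ j, (y ^ q ^ j) ^ q = y ^ q ^ (j + 1) := fun j => by rw [← pow_mul, ← pow_succ]
  simp only [h1]
  obtain ⟨N, rfl⟩ : ∃ N, n = N + 1 := Nat.exists_eq_succ_of_ne_zero (NeZero.ne n)
  rw [Finset.sum_range_succ, Finset.sum_range_succ' (fun j => y ^ q ^ j), ← hE, FiniteField.pow_card]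
  simp

lemma phi_lem (q C t : ℤ) (hC : 0 ≤ C) (hC2 : 2 * C ≤ q) (hq : 3 ≤ q) :
    (t = 0 ∧ |q * t - C| - |t| - C = 0) ∨ (t = 1 ∧ |q * t - C| - |t| - C = q - 1 - 2 * C) ∨
    (q - 1 ≤ |q * t - C| - |t| - C) ∨ (2 * (q - 1) - 2 * C ≤ |q * t - C| - |t| - C) := by
  rcases lt_trichotomy t 0 with h | h | h
  · right; right; left
    have : q * t < 0 := by nlinarith
    rw [abs_of_neg (by linarith), abs_of_neg h]; nlinarith
  · left; subst h; simp [abs_of_nonneg hC]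
  · right
    rcases eq_or_lt_of_le (show 1 ≤ t by omega) with h1 | h1
    · left; subst h1; refine ⟨rfl, ?_⟩
      rw [abs_of_nonneg (by linarith)]; norm_num; ring
    · right; right
      rw [abs_of_nonneg (by nlinarith), abs_of_pos h]; nlinarith

lemma four_sum {α : Type*} [Fintype α] [DecidableEq α] (g : α → ℤ) (hg : ∀ x, 0 ≤ g x)
    (x y : α) (h : x ≠ y) : g x + g y ≤ ∑ z, g z := by
  rw [← Finset.sum_pair h]
  exact Finset.sum_le_univ_sum_of_nonneg hg

lemma int_huS (q a b P1 P2 P3 P4 T u1 u2 u3 u4 : ℤ) (hab : a + b + 1 = q) (hba : b ≤ a)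
    (hb : 0 ≤ b) (ha : a ≤ b + 1) (hq : 3 ≤ q)
    (p1 : (u1 = 0 ∧ P1 = 0) ∨ (u1 = 1 ∧ P1 = q - 1 - 2 * a) ∨ (q - 1 ≤ P1) ∨ (2 * (q - 1) - 2 * a ≤ P1))
    (p2 : (u2 = 0 ∧ P2 = 0) ∨ (u2 = 1 ∧ P2 = q - 1 - 2 * b) ∨ (q - 1 ≤ P2) ∨ (2 * (q - 1) - 2 * b ≤ P2))
    (p3 : (u3 = 0 ∧ P3 = 0) ∨ (u3 = 1 ∧ P3 = q - 1 - 2 * a) ∨ (q - 1 ≤ P3) ∨ (2 * (q - 1) - 2 * a ≤ P3))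
    (p4 : (u4 = 0 ∧ P4 = 0) ∨ (u4 = 1 ∧ P4 = q - 1 - 2 * b) ∨ (q - 1 ≤ P4) ∨ (2 * (q - 1) - 2 * b ≤ P4))
    (hs : P3 + P4 + P1 + P2 + T ≤ 0) (hT : 0 ≤ T) :
    T < q - 1 ∧ (u1 = 0 ∨ u1 = 1) ∧ (u2 = 0 ∨ u2 = 1) ∧ (u3 = 0 ∨ u3 = 1) ∧ (u4 = 0 ∨ u4 = 1) := by
  have b1 : b - a ≤ P1 ∧ ((u1 = 0 ∨ u1 = 1) ∨ q - 1 - (a - b) ≤ P1) := by clear p2 p3 p4; omega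
  have b2 : 0 ≤ P2 ∧ ((u2 = 0 ∨ u2 = 1) ∨ q - 1 ≤ P2) := by clear p1 p3 p4; omega
  have b3 : b - a ≤ P3 ∧ ((u3 = 0 ∨ u3 = 1) ∨ q - 1 - (a - b) ≤ P3) := by clear p2 p1 p4; omega
  have b4 : 0 ≤ P4 ∧ ((u4 = 0 ∨ u4 = 1) ∨ q - 1 ≤ P4) := by clear p2 p3 p1; omega
  clear p1 p2 p3 p4
  obtain ⟨b1, b1'⟩ := b1
  obtain ⟨b2, b2'⟩ := b2
  obtain ⟨b3, b3'⟩ := b3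
  obtain ⟨b4, b4'⟩ := b4
  refine ⟨by omega, b1'.resolve_right ?_, b2'.resolve_right ?_, b3'.resolve_right ?_,
    b4'.resolve_right ?_⟩
  all_goals clear b1' b2' b3' b4'; intro; omega

lemma core {n : ℕ} [NeZero n] (hn : 3 ≤ n) (q a b : ℤ) (hab : a + b + 1 = q) (hba : b ≤ a)
    (hb : 0 ≤ b) (ha : a ≤ b + 1) (hq : 3 ≤ q) (M : ZMod n × ZMod n → ℤ) (hM0 : ∀ e, 0 ≤ M e)
    (hM : ∑ e, M e ≤ q - 1) (i k1 k2 l1 l2 : ZMod n) (hl1 : l1 = k1 + i) (hl2 : l2 = k2 + i)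
    (hi : i + i ≠ 0) (hk : k1 ≠ k2) (hk12 : k2 ≠ l1) (hk21 : k1 ≠ l2)
    (hA1 : M (k1, l1) = 0) (hA2 : M (k2, l2) = 0)
    (hX : M (l1, k2) = 0 ∨ M (l2, k1) = 0)
    (c u : ZMod n → ℤ) (hc1 : c l1 = a) (hc2 : c l2 = b) (hc3 : c k1 = -a)
    (hc4 : c k2 = - b) (hc0 : ∀ x, x ≠ k1 → x ≠ k2 → x ≠ l1 → x ≠ l2 → c x = 0)
    (hu : ∀ x, c x - (∑ k, M (x, k) - ∑ l, M (l, x)) = q * u x - u (x - 1)) :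
    M (l1, k1) = a ∧ M (l2, k2) = b ∧ ∀ e, e ≠ (l1, k1) → e ≠ (l2, k2) → M e = 0 := by
  classical
  have hi0 : i ≠ 0 := by rintro rfl; simp at hi
  have hkl1 : k1 ≠ l1 := by rw [hl1]; simpa using hi0
  have hkl2 : k2 ≠ l2 := by rw [hl2]; simpa using hi0
  have hll : l1 ≠ l2 := by rw [hl1, hl2]; simpa using hk
  have hone : (1 : ZMod n) ≠ 0 := by
    have : Fact (1 < n) := ⟨by omega⟩
    exact one_ne_zero
  have htwo : (1 : ZMod n) + 1 ≠ 0 := by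
    intro h
    have : ((2 : ℕ) : ZMod n) = 0 := by push_cast; rw [← h]; ring
    rw [ZMod.natCast_eq_zero_iff] at this
    have := Nat.le_of_dvd (by norm_num) this
    omega
  set In : ZMod n → ℤ := fun x => ∑ k, M (x, k) with hIn
  set Out : ZMod n → ℤ := fun x => ∑ l, M (l, x) with hOut
  have hIn0 : ∀ x, 0 ≤ In x := fun x => Finset.sum_nonneg fun k _ => hM0 _
  have hOut0 : ∀ x, 0 ≤ Out x := fun x => Finset.sum_nonneg fun k _ => hM0 _
  have hInS : ∑ x, In x = ∑ e, M e := by rw [Fintype.sum_prod_type]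
  have hOutS : ∑ x, Out x = ∑ e, M e := by rw [Fintype.sum_prod_type, Finset.sum_comm]
  have hInOut : ∀ x y, In x + Out y ≤ q - 1 + M (x, y) := by
    intro x y
    have h1 : ∑ e, M e = In x + ∑ x' ∈ Finset.univ.erase x, In x' := by
      rw [← hInS, Finset.add_sum_erase _ _ (Finset.mem_univ _)]
    have h2 : Out y = M (x, y) + ∑ x' ∈ Finset.univ.erase x, M (x', y) := by
      rw [hOut]; simp only; rw [Finset.add_sum_erase _ (fun l => M (l, y)) (Finset.mem_univ _)]
    have h3 : ∑ x' ∈ Finset.univ.erase x, M (x', y) ≤ ∑ x' ∈ Finset.univ.erase x, In x' :=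
      Finset.sum_le_sum fun x' _ =>
        Finset.single_le_sum (f := fun k => M (x', k)) (fun k _ => hM0 _) (Finset.mem_univ y)
    linarith
  have hInP : ∀ x y, x ≠ y → In x + In y ≤ q - 1 := fun x y h =>
    (four_sum In hIn0 x y h).trans (hInS ▸ hM)
  have hOutP : ∀ x y, x ≠ y → Out x + Out y ≤ q - 1 := fun x y h =>
    (four_sum Out hOut0 x y h).trans (hOutS ▸ hM)
  have hu' : ∀ x, In x - Out x = c x - q * u x + u (x - 1) := fun x => by
    have := hu x
    simp only [hIn, hOut]; linarith
  have hshift : ∀ f : ZMod n → ℤ, ∑ x, f (x - 1) = ∑ x, f x := fun f =>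
    Equiv.sum_comp (Equiv.subRight (1 : ZMod n)) f
  -- splitting sums
  set S : Finset (ZMod n) := {k1, k2, l1, l2} with hS
  have hsplit : ∀ f : ZMod n → ℤ, ∑ x, f x = f k1 + f k2 + f l1 + f l2 + ∑ x ∈ Sᶜ, f x := by
    intro f
    rw [← Finset.sum_add_sum_compl S f, hS, Finset.sum_insert, Finset.sum_insert,
      Finset.sum_insert, Finset.sum_singleton]
    · ring
    · simpa using hll
    · simp [hkl2, hk12]
    · simp [hk, hkl1, hk21]
  have hcS : ∀ x ∈ Sᶜ, c x = 0 := by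
    intro x hx
    simp only [hS, Finset.mem_compl, Finset.mem_insert, Finset.mem_singleton, not_or] at hx
    exact hc0 x hx.1 hx.2.1 hx.2.2.1 hx.2.2.2
  set φ : ZMod n → ℤ := fun x => |q * u x - c x| - |u x| - |c x| with hφ
  have hφsum : ∑ x, φ x ≤ 0 := by
    have h1 : ∀ x, |q * u x - c x| - |u (x - 1)| ≤ In x + Out x := by
      intro x
      have e : q * u x - c x = u (x - 1) - (In x - Out x) := by rw [hu' x]; ring
      rw [e]
      have := abs_sub (u (x-1)) (In x - Out x)
      have h2 := abs_sub (In x) (Out x)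
      rw [abs_of_nonneg (hIn0 x), abs_of_nonneg (hOut0 x)] at h2
      linarith
    have h2 := Finset.sum_le_sum (fun x (_ : x ∈ Finset.univ) => h1 x)
    rw [Finset.sum_sub_distrib, Finset.sum_add_distrib, hshift (fun x => |u x|), hInS, hOutS] at h2
    have h3 : ∑ x, |c x| = 2 * (a + b) := by
      rw [hsplit, Finset.sum_eq_zero (fun x hx => by rw [hcS x hx, abs_zero]), hc1, hc2, hc3, hc4,
        abs_neg, abs_neg, abs_of_nonneg hb, abs_of_nonneg (hb.trans hba)]
      ring
    simp only [hφ, Finset.sum_sub_distrib]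
    linarith
  have hφS : ∀ x ∈ Sᶜ, φ x = (q - 1) * |u x| := by
    intro x hx
    simp only [hφ, hcS x hx, sub_zero, abs_zero, abs_mul, abs_of_nonneg (show (0:ℤ) ≤ q by omega)]
    ring
  have hrest : ∀ y ∈ Sᶜ, φ y ≤ ∑ x ∈ Sᶜ, φ x := fun y hy =>
    Finset.single_le_sum (f := φ) (fun x hx => by
      rw [hφS x hx]; exact mul_nonneg (by omega) (abs_nonneg _)) hy
  have hrest0 : 0 ≤ ∑ x ∈ Sᶜ, φ x := Finset.sum_nonneg fun x hx => by
      rw [hφS x hx]; exact mul_nonneg (by omega) (abs_nonneg _)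
  have hsp := hsplit φ
  have f1 : φ l1 = |q * u l1 - a| - |u l1| - a := by
    simp only [hφ, hc1]; rw [abs_of_nonneg (show 0 ≤ a by omega)]
  have f2 : φ l2 = |q * u l2 - b| - |u l2| - b := by
    simp only [hφ, hc2]; rw [abs_of_nonneg (show 0 ≤ b by omega)]
  have f3 : φ k1 = |q * (-u k1) - a| - |-u k1| - a := by
    simp only [hφ, hc3]; rw [abs_neg a, abs_of_nonneg (show 0 ≤ a by omega), abs_neg (u k1),
      ← abs_neg (q * -u k1 - a)]; ring_nf
  have f4 : φ k2 = |q * (-u k2) - b| - |-u k2| - b := by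
    simp only [hφ, hc4]; rw [abs_neg b, abs_of_nonneg (show 0 ≤ b by omega), abs_neg (u k2),
      ← abs_neg (q * -u k2 - b)]; ring_nf
  have p1 := phi_lem q a (u l1) (by omega) (by omega) hq
  have p2 := phi_lem q b (u l2) (by omega) (by omega) hq
  have p3 := phi_lem q a (-u k1) (by omega) (by omega) hq
  have p4 := phi_lem q b (-u k2) (by omega) (by omega) hq
  rw [← f1] at p1
  rw [← f2] at p2
  rw [← f3] at p3
  rw [← f4] at p4
  obtain ⟨hTq, hul1, hul2, huk1', huk2'⟩ := int_huS q a b _ _ _ _ (∑ x ∈ Sᶜ, φ x) _ _ _ _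
    hab hba hb ha hq p1 p2 p3 p4 (by linarith) hrest0
  have huS : ∀ x ∈ Sᶜ, u x = 0 := by
    intro x hx
    by_contra hne
    have h1 : 1 ≤ |u x| := Int.one_le_abs hne
    have h2 := hrest x hx
    have h3 : q - 1 ≤ φ x := by rw [hφS x hx]; nlinarith
    linarith
  have huk1 : u k1 = 0 ∨ u k1 = -1 := by clear * - huk1'; omega
  have huk2 : u k2 = 0 ∨ u k2 = -1 := by clear * - huk2'; omega
  clear p1 p2 p3 p4 f1 f2 f3 f4
  have husum : u k1 + u k2 + u l1 + u l2 = 0 := by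
    have h1 : ∑ x, (In x - Out x) = 0 := by rw [Finset.sum_sub_distrib, hInS, hOutS, sub_self]
    rw [Finset.sum_congr rfl (fun x _ => hu' x), Finset.sum_add_distrib, Finset.sum_sub_distrib,
      hshift, ← Finset.mul_sum, hsplit c, Finset.sum_eq_zero hcS, hc1, hc2, hc3, hc4, hsplit u,
      Finset.sum_eq_zero huS] at h1
    have : (q - 1) * (u k1 + u k2 + u l1 + u l2) = 0 := by linarith
    rcases mul_eq_zero.1 this with h | h
    · omega
    · exact h
  have huval : ∀ x, (x = k1 ∨ x = k2 ∨ x = l1 ∨ x = l2) ∨ u x = 0 := by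
    intro x
    by_cases hx : x ∈ S
    · left; simpa [hS] using hx
    · right; exact huS x (by simpa using hx)
  have hne1 : ∀ x : ZMod n, x - 1 ≠ x := fun x h => hone (by simpa using h)
  have wk1 := hu' k1
  have wk2 := hu' k2
  have wl1 := hu' l1
  have wl2 := hu' l2
  rw [hc3] at wk1
  rw [hc4] at wk2
  rw [hc1] at wl1
  rw [hc2] at wl2
  have ik1 := hIn0 k1
  have ik2 := hIn0 k2
  have il1 := hIn0 l1
  have il2 := hIn0 l2
  have ok1 := hOut0 k1
  have ok2 := hOut0 k2
  have ol1 := hOut0 l1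
  have ol2 := hOut0 l2
  have vk1 := huval (k1 - 1)
  have vk2 := huval (k2 - 1)
  have vl1 := huval (l1 - 1)
  have vl2 := huval (l2 - 1)
  have uzero : u k1 = 0 ∧ u k2 = 0 ∧ u l1 = 0 ∧ u l2 = 0 := by
    rcases hul1 with x1 | x1 <;> rcases hul2 with x2 | x2 <;> rcases huk1 with y1 | y1 <;>
      rcases huk2 with y2 | y2 <;> try omega
    all_goals exfalso
    all_goals rw [x1] at wl1
    all_goals rw [x2] at wl2
    all_goals rw [y1] at wk1
    all_goals rw [y2] at wk2
    · -- l2, k2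
      have h1 : 0 ≤ u (k2 - 1) := by
        rcases vk2 with (h | h | h | h) | h
        · rw [h]; omega
        · exact absurd h (hne1 _)
        · rw [h]; omega
        · rw [h]; omega
        · omega
      have h2 : u (l2 - 1) ≤ 0 := by
        rcases vl2 with (h | h | h | h) | h
        · rw [h]; omega
        · rw [h]; omega
        · rw [h]; omega
        · exact absurd h (hne1 _)
        · omega
      have := hInOut k2 l2
      omega
    · -- l2, k1
      have h1 : 0 ≤ u (k1 - 1) := by
        rcases vk1 with (h | h | h | h) | h
        · exact absurd h (hne1 _)
        · rw [h]; omega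
        · rw [h]; omega
        · rw [h]; omega
        · omega
      have h2 : u (l2 - 1) ≤ 0 := by
        rcases vl2 with (h | h | h | h) | h
        · rw [h]; omega
        · rw [h]; omega
        · rw [h]; omega
        · exact absurd h (hne1 _)
        · omega
      have h3 := hInP k1 l1 hkl1
      have h4 := hOutP l2 k2 hkl2.symm
      have h5 : l1 - 1 = k1 := by
        rcases vl1 with (h | h | h | h) | h
        · exact h
        all_goals (exfalso; rw [h] at wl1; try rw [y2] at wl1)
        all_goals try rw [x1] at wl1
        all_goals try rw [x2] at wl1
        all_goals omega
      have h6 : k2 - 1 = l2 := by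
        rcases vk2 with (h | h | h | h) | h
        · exfalso; rw [h, y1] at wk2; omega
        · exact absurd h (hne1 _)
        · exfalso; rw [h, x1] at wk2; omega
        · exact h
        · exfalso; rw [h] at wk2; omega
      apply hi
      rw [hl1] at h5
      rw [hl2] at h6
      linear_combination h5 - h6
    · -- l1, k2
      have h1 : 0 ≤ u (k2 - 1) := by
        rcases vk2 with (h | h | h | h) | h
        · rw [h]; omega
        · exact absurd h (hne1 _)
        · rw [h]; omega
        · rw [h]; omega
        · omega
      have h2 : u (l1 - 1) ≤ 0 := by
        rcases vl1 with (h | h | h | h) | h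
        · rw [h]; omega
        · rw [h]; omega
        · exact absurd h (hne1 _)
        · rw [h]; omega
        · omega
      have h3 := hInP k2 l2 hkl2
      have h4 := hOutP l1 k1 hkl1.symm
      have h5 : l2 - 1 = k2 := by
        rcases vl2 with (h | h | h | h) | h
        · exfalso; rw [h, y1] at wl2; omega
        · exact h
        · exfalso; rw [h, x1] at wl2; omega
        · exact absurd h (hne1 _)
        · exfalso; rw [h] at wl2; omega
      have h6 : k1 - 1 = l1 := by
        rcases vk1 with (h | h | h | h) | h
        · exact absurd h (hne1 _)
        · exfalso; rw [h, y2] at wk1; omega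
        · exact h
        · exfalso; rw [h, x2] at wk1; omega
        · exfalso; rw [h] at wk1; omega
      apply hi
      rw [hl2] at h5
      rw [hl1] at h6
      linear_combination h5 - h6
    · -- l1, k1
      have h1 : 0 ≤ u (k1 - 1) := by
        rcases vk1 with (h | h | h | h) | h
        · exact absurd h (hne1 _)
        · rw [h]; omega
        · rw [h]; omega
        · rw [h]; omega
        · omega
      have h2 : u (l1 - 1) ≤ 0 := by
        rcases vl1 with (h | h | h | h) | h
        · rw [h]; omega
        · rw [h]; omega
        · exact absurd h (hne1 _)
        · rw [h]; omega
        · omega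
      have := hInOut k1 l1
      omega
    · -- all
      have h1 : -1 ≤ u (k1 - 1) ∧ (k1 - 1 = k2 ∨ 0 ≤ u (k1 - 1)) := by
        rcases vk1 with (h | h | h | h) | h
        · exact absurd h (hne1 _)
        · rw [h, y2]; exact ⟨le_refl _, Or.inl rfl⟩
        · rw [h]; omega
        · rw [h]; omega
        · omega
      have h2 : -1 ≤ u (k2 - 1) ∧ (k2 - 1 = k1 ∨ 0 ≤ u (k2 - 1)) := by
        rcases vk2 with (h | h | h | h) | h
        · rw [h, y1]; exact ⟨le_refl _, Or.inl rfl⟩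
        · exact absurd h (hne1 _)
        · rw [h]; omega
        · rw [h]; omega
        · omega
      have h3 := hInP k1 k2 hk
      rcases h1 with ⟨h1, h1' | h1'⟩
      · rcases h2 with ⟨h2, h2' | h2'⟩
        · apply htwo
          linear_combination - h1' - h2'
        · omega
      · omega
  obtain ⟨z1, z2, z3, z4⟩ := uzero
  have uall : ∀ x, u x = 0 := by
    intro x
    rcases huval x with (h | h | h | h) | h
    · rw [h, z1]
    · rw [h, z2]
    · rw [h, z3]
    · rw [h, z4]
    · exact h
  rw [z3, uall] at wl1
  rw [z4, uall] at wl2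
  rw [z1, uall] at wk1
  rw [z2, uall] at wk2
  have g1 := hInP l1 l2 hll
  have g2 := hOutP k1 k2 hk
  have hInz : ∀ x, x ≠ l1 → x ≠ l2 → In x = 0 := by
    intro x h1 h2
    have : ∑ z ∈ ({x, l1, l2} : Finset (ZMod n)), In z ≤ ∑ z, In z :=
      Finset.sum_le_univ_sum_of_nonneg hIn0
    rw [Finset.sum_insert (by simp [h1, h2]), Finset.sum_pair hll, hInS] at this
    have := hIn0 x
    omega
  have hOutz : ∀ x, x ≠ k1 → x ≠ k2 → Out x = 0 := by
    intro x h1 h2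
    have : ∑ z ∈ ({x, k1, k2} : Finset (ZMod n)), Out z ≤ ∑ z, Out z :=
      Finset.sum_le_univ_sum_of_nonneg hOut0
    rw [Finset.sum_insert (by simp [h1, h2]), Finset.sum_pair hk, hOutS] at this
    have := hOut0 x
    omega
  have hMIn : ∀ x y, M (x, y) ≤ In x := fun x y =>
    Finset.single_le_sum (f := fun k => M (x, k)) (fun k _ => hM0 _) (Finset.mem_univ y)
  have hMOut : ∀ x y, M (x, y) ≤ Out y := fun x y =>
    Finset.single_le_sum (f := fun l => M (l, y)) (fun k _ => hM0 _) (Finset.mem_univ x)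
  have hMz1 : ∀ x y, x ≠ l1 → x ≠ l2 → M (x, y) = 0 := fun x y h1 h2 => by
    have := hMIn x y; have := hInz x h1 h2; have := hM0 (x, y); omega
  have hMz2 : ∀ x y, y ≠ k1 → y ≠ k2 → M (x, y) = 0 := fun x y h1 h2 => by
    have := hMOut x y; have := hOutz y h1 h2; have := hM0 (x, y); omega
  have s1 : In l1 = M (l1, k1) + M (l1, k2) := by
    rw [← Finset.sum_pair (f := fun k => M (l1, k)) hk]
    symm
    apply Finset.sum_subset (Finset.subset_univ _)
    intro x _ hx
    simp at hx
    exact hMz2 _ _ hx.1 hx.2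
  have s2 : In l2 = M (l2, k1) + M (l2, k2) := by
    rw [← Finset.sum_pair (f := fun k => M (l2, k)) hk]
    symm
    apply Finset.sum_subset (Finset.subset_univ _)
    intro x _ hx
    simp at hx
    exact hMz2 _ _ hx.1 hx.2
  have s3 : Out k1 = M (l1, k1) + M (l2, k1) := by
    rw [← Finset.sum_pair (f := fun l => M (l, k1)) hll]
    symm
    apply Finset.sum_subset (Finset.subset_univ _)
    intro x _ hx
    simp at hx
    exact hMz1 _ _ hx.1 hx.2
  have s4 : Out k2 = M (l1, k2) + M (l2, k2) := by
    rw [← Finset.sum_pair (f := fun l => M (l, k2)) hll]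
    symm
    apply Finset.sum_subset (Finset.subset_univ _)
    intro x _ hx
    simp at hx
    exact hMz1 _ _ hx.1 hx.2
  have m1 := hM0 (l1, k1)
  have m2 := hM0 (l1, k2)
  have m3 := hM0 (l2, k1)
  have m4 := hM0 (l2, k2)
  have hcr1 : M (l1, k2) = 0 := by omega
  have hcr2 : M (l2, k1) = 0 := by omega
  refine ⟨by omega, by omega, ?_⟩
  rintro ⟨x, y⟩ h1 h2
  by_cases hx1 : x = l1
  · subst hx1
    by_cases hy1 : y = k1
    · subst hy1; exact absurd rfl h1
    · by_cases hy2 : y = k2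
      · subst hy2; exact hcr1
      · exact hMz2 _ _ hy1 hy2
  · by_cases hx2 : x = l2
    · subst hx2
      by_cases hy1 : y = k2
      · subst hy1; exact absurd rfl h2
      · by_cases hy2 : y = k1
        · subst hy2; exact hcr2
        · exact hMz2 _ _ hy2 hy1
    · exact hMz1 _ _ hx1 hx2

lemma choose_not_dvd (p m q : ℕ) (hp : p.Prime) (hq : q = p ^ m) (k : ℕ) (hk : k < q) :
    ¬ p ∣ Nat.choose (q - 1) k := by
  induction k with
  | zero => simp; exact hp.one_lt.ne'
  | succ k ih =>
    intro h
    apply ih (by omega)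
    have h1 : p ∣ Nat.choose q (k + 1) := by
      rw [hq]; exact hp.dvd_choose_pow (by omega) (by omega)
    obtain ⟨r, rfl⟩ : ∃ r, q = r + 1 := ⟨q - 1, by omega⟩
    rw [Nat.choose_succ_succ] at h1
    rw [Nat.add_sub_cancel] at h ⊢
    exact (Nat.dvd_add_left h).1 h1

lemma multinomial_two {ι : Type*} [Fintype ι] [DecidableEq ι] (e1 e2 : ι) (h : e1 ≠ e2) (a b : ℕ) :
    Nat.multinomial Finset.univ (fun e => if e = e1 then a else if e = e2 then b else 0) =
      Nat.choose (a + b) a := by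
  have hs : ∀ {R : Type} [AddCommMonoid R] (f : ι → R), (∀ e, e ≠ e1 → e ≠ e2 → f e = 0) →
      ∑ e, f e = f e1 + f e2 := by
    intro R _ f hf
    rw [← Finset.sum_pair h]
    symm
    apply Finset.sum_subset (Finset.subset_univ _)
    intro x _ hx
    simp at hx
    exact hf x hx.1 hx.2
  have hp : ∏ e, (if e = e1 then a else if e = e2 then b else 0).factorial = a.factorial * b.factorial := by
    have : ∏ e ∈ ({e1, e2} : Finset ι), (if e = e1 then a else if e = e2 then b else 0).factorial =
        ∏ e, (if e = e1 then a else if e = e2 then b else 0).factorial := by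
      apply Finset.prod_subset (Finset.subset_univ _)
      intro x _ hx
      simp at hx
      simp [hx.1, hx.2]
    rw [← this, Finset.prod_pair h]
    simp [h.symm]
  rw [Nat.multinomial, hp, hs]
  · simp only [if_true, if_neg h.symm]
    rw [Nat.choose_eq_factorial_div_factorial (by omega), Nat.add_sub_cancel_left]
  · intro e h1 h2; simp [h1, h2]

lemma main_case {E : Type*} [Field E] [Fintype E] (p m q n : ℕ) [Fact p.Prime] [CharP E p]
    (hq : q = p ^ m) (hq3 : 3 ≤ q) [NeZero n] (hn : 4 ≤ n) (hE : Fintype.card E = q ^ n) (A : ℕ → E)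
    (hF : ∀ x : Eˣ, (∑ e : ZMod n × ZMod n,
      coefA q A e * (x : E) ^ ((q : ℤ) ^ e.1.val - (q : ℤ) ^ e.2.val)) ^ (q - 1) = 1)
    (i : ZMod n) (hi0 : i ≠ 0) (hi : A i.val ≠ 0)
    (hanti : ∀ i : ZMod n, i ≠ 0 → A i.val ≠ 0 → A (-i).val = 0) : False := by
  classical
  have hanti' : ∀ l k : ZMod n, l ≠ k → A (l - k).val ≠ 0 → coefA q A (k, l) = 0 := by
    intro l k hlk h
    have := hanti _ (sub_ne_zero.2 hlk) h
    rw [neg_sub] at this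
    have hq0 : q ≠ 0 := by omega
    simp [coefA, this, hq0]
  have hii : i + i ≠ 0 := by
    intro h
    apply hi
    have : A (-i).val = 0 := hanti i hi0 hi
    rwa [neg_eq_of_add_eq_zero_left h] at this
  have hcz : ∀ l k : ZMod n, A (l - k).val = 0 → coefA q A (l, k) = 0 := by
    intro l k h
    have hq0 : q ≠ 0 := by omega
    simp [coefA, h, hq0]
  obtain ⟨δ, hδ0, hδ1, hδ2, hδ⟩ : ∃ δ : ZMod n, δ ≠ 0 ∧ δ ≠ i ∧ δ ≠ -i ∧
      (A (i + δ).val = 0 ∨ A (i - δ).val = 0) := by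
    by_cases h3 : i + i + i = 0
    · obtain ⟨g, hg⟩ : ∃ g : ZMod n, g ∉ ({0, i, -i} : Finset (ZMod n)) := by
        by_contra! hcon
        have : (Finset.univ : Finset (ZMod n)) ⊆ {0, i, -i} := fun x _ => hcon x
        have := Finset.card_le_card this
        rw [Finset.card_univ, ZMod.card] at this
        have := Finset.card_le_three (a := (0 : ZMod n)) (b := i) (c := -i)
        omega
      simp only [Finset.mem_insert, Finset.mem_singleton, not_or] at hg
      obtain ⟨g0, g1, g2⟩ := hg
      by_cases hA : A (i + g).val = 0
      · exact ⟨g, g0, g1, g2, Or.inl hA⟩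
      · refine ⟨i - g, sub_ne_zero.2 (Ne.symm g1), ?_, ?_, Or.inl ?_⟩
        · simpa using g0
        · intro h; apply g2; linear_combination h3 - h
        · have := hanti (i + g) (by intro h; apply g2; linear_combination h) hA
          rwa [show -(i + g) = i + (i - g) by linear_combination -h3] at this
    · refine ⟨-(i + i), neg_ne_zero.2 hii, ?_, ?_, Or.inl ?_⟩
      · intro h; apply h3; linear_combination -h
      · intro h; apply hi0; linear_combination -h
      · have := hanti i hi0 hi
        rwa [show i + -(i + i) = -i by ring]
  obtain ⟨a, b, hab, hba, ha⟩ : ∃ a b : ℕ, a + b + 1 = q ∧ b ≤ a ∧ a ≤ b + 1 :=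
    ⟨q / 2, q - 1 - q / 2, by omega, by omega, by omega⟩
  have hk12 : δ ≠ i := hδ1
  have hk21 : (0 : ZMod n) ≠ δ + i := by
    intro h; apply hδ2; linear_combination -h
  have hA1 : coefA q A (0, i) = 0 := hanti' i 0 hi0 (by simpa using hi)
  have hA2 : coefA q A (δ, δ + i) = 0 :=
    hanti' (δ + i) δ (by simpa using hi0) (by simpa using hi)
  have hX : coefA q A (i, δ) = 0 ∨ coefA q A (δ + i, 0) = 0 := by
    rcases hδ with h | h
    · right; apply hcz; rwa [sub_zero, add_comm]
    · left; apply hcz; exact h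
  let c : ZMod n → ℤ := fun x => (a : ℤ) * ((if x = i then 1 else 0) - (if x = 0 then 1 else 0)) +
    (b : ℤ) * ((if x = δ + i then 1 else 0) - (if x = δ then 1 else 0))
  let cv : ℤ := (a : ℤ) * ((q : ℤ) ^ i.val - (q : ℤ) ^ (0 : ZMod n).val) +
    (b : ℤ) * ((q : ℤ) ^ (δ + i).val - (q : ℤ) ^ δ.val)
  have hcv : ∑ x, c x * (q : ℤ) ^ x.val = cv := by
    simp only [c, cv, add_mul, mul_assoc, sub_mul, Finset.sum_add_distrib, ← Finset.mul_sum,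
      Finset.sum_sub_distrib, ite_mul, one_mul, zero_mul, Finset.sum_ite_eq', Finset.mem_univ, if_true]
  have hiδ : i ≠ δ + i := by simpa using hδ0
  have hδi : δ ≠ δ + i := by simpa using hi0
  have hcore : ∀ M : ZMod n × ZMod n → ℤ, (∀ e, 0 ≤ M e) → ∑ e, M e ≤ (q : ℤ) - 1 →
      (∀ e, coefA q A e = 0 → M e = 0) →
      ((Fintype.card E : ℤ) - 1) ∣ (∑ e, M e * ((q : ℤ) ^ e.1.val - (q : ℤ) ^ e.2.val)) - cv →
      M (i, 0) = a ∧ M (δ + i, δ) = b ∧ ∀ e, e ≠ (i, 0) → e ≠ (δ + i, δ) → M e = 0 := by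
    intro M hM0 hM hMA hd
    have hsum : (∑ e, M e * ((q : ℤ) ^ e.1.val - (q : ℤ) ^ e.2.val)) =
        ∑ x, (∑ k, M (x, k) - ∑ l, M (l, x)) * (q : ℤ) ^ x.val := by
      simp only [mul_sub, sub_mul, Finset.sum_sub_distrib, Finset.sum_mul]
      congr 1
      · rw [Fintype.sum_prod_type]
      · rw [Fintype.sum_prod_type, Finset.sum_comm]
    have hd2 : ((q : ℤ) ^ n - 1) ∣ ∑ x, (c x - (∑ k, M (x, k) - ∑ l, M (l, x))) * (q : ℤ) ^ x.val := by
      rw [hE, ← dvd_neg] at hd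
      push_cast at hd
      have e : ∑ x, (c x - (∑ k, M (x, k) - ∑ l, M (l, x))) * (q : ℤ) ^ x.val =
          -((∑ e, M e * ((q : ℤ) ^ e.1.val - (q : ℤ) ^ e.2.val)) - cv) := by
        rw [hsum, ← hcv]
        simp only [sub_mul, Finset.sum_sub_distrib]; ring
      rw [e]; exact hd
    obtain ⟨u, hu⟩ := carry (q : ℤ) _ hd2
    exact core (by omega) q a b (by omega) (by omega) (by omega) (by omega) (by omega) M hM0 hM
      i 0 δ i (δ + i) (by ring) rfl hii hδ0.symm hk12 hk21 (hMA _ hA1) (hMA _ hA2)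
      (hX.imp (hMA _) (hMA _)) c u (by simp [c, hi0, hiδ, hδ1.symm]) (by simp [c, hiδ.symm, hk21.symm, hδ0, hi0])
      (by simp [c, hi0.symm, hδ0.symm, hk21]) (by simp [c, hk12, hδ0, hδi])
      (by intro x h1 h2 h3 h4; simp [c, h1, h2, h3, h4]) hu
  have hne : ((i, 0) : ZMod n × ZMod n) ≠ (δ + i, δ) := by
    intro h; exact hiδ (Prod.ext_iff.1 h).1
  let M0 : ZMod n × ZMod n → ℕ := fun e => if e = (i, 0) then a else if e = (δ + i, δ) then b else 0
  have hs : ∀ {R : Type} [AddCommMonoid R] (f : ZMod n × ZMod n → R),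
      (∀ e, e ≠ (i, 0) → e ≠ (δ + i, δ) → f e = 0) → ∑ e, f e = f (i, 0) + f (δ + i, δ) := by
    intro R _ f hf
    rw [← Finset.sum_pair hne]
    symm
    apply Finset.sum_subset (Finset.subset_univ _)
    intro x _ hx
    simp only [Finset.mem_insert, Finset.mem_singleton, not_or] at hx
    exact hf x hx.1 hx.2
  have hM0z : ∀ e, e ≠ (i, 0) → e ≠ (δ + i, δ) → M0 e = 0 := by
    intro e h1 h2; simp only [M0, if_neg h1, if_neg h2]
  have hM01 : M0 (i, 0) = a := by simp only [M0, if_true]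
  have hM02 : M0 (δ + i, δ) = b := by simp only [M0, if_true, if_neg hne.symm]
  have key := expand_contra (E := E) (coefA q A) (fun e : ZMod n × ZMod n => (q : ℤ) ^ e.1.val - (q : ℤ) ^ e.2.val)
    (q - 1) cv hF ?_ M0 ?_ ?_ ?_
  · rw [multinomial_two _ _ hne] at key
    rcases mul_eq_zero.1 key with h | h
    · rw [CharP.cast_eq_zero_iff E p] at h
      refine choose_not_dvd p m q Fact.out hq a (by omega) ?_
      rwa [show q - 1 = a + b by omega]
    · rw [Finset.prod_eq_zero_iff] at h
      obtain ⟨e, -, he⟩ := h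
      by_cases h1 : e = (i, 0)
      · subst h1
        have := eq_zero_of_pow_eq_zero he
        simp [coefA, hi0, hi] at this
      · by_cases h2 : e = (δ + i, δ)
        · subst h2
          have := eq_zero_of_pow_eq_zero he
          simp [coefA, hi0, hi] at this
        · rw [hM0z e h1 h2] at he; simp at he
  · intro hd
    have := hcore (fun _ => 0) (fun _ => le_rfl) (by simp; omega) (fun _ _ => rfl) (by simpa using hd)
    omega
  · rw [hs M0 hM0z, hM01, hM02]; omega
  · rw [hs _ (fun e h1 h2 => by rw [hM0z e h1 h2]; simp), hM01, hM02]
    simp [cv]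
  · intro M hM hMA hd
    have := hcore (fun e => (M e : ℤ)) (fun _ => by positivity)
      (by rw [← Nat.cast_sum, hM]; omega) (fun e he => by simp [hMA e he]) hd
    obtain ⟨h1, h2, h3⟩ := this
    funext e
    by_cases g1 : e = (i, 0)
    · rw [g1, hM01]; exact_mod_cast h1
    · by_cases g2 : e = (δ + i, δ)
      · rw [g2, hM02]; exact_mod_cast h2
      · rw [hM0z e g1 g2]; exact_mod_cast h3 e g1 g2

lemma q2_contra {E : Type*} [Field E] [Fintype E] (q n : ℕ) (hq2 : 2 ≤ q) [NeZero n]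
    (hE : Fintype.card E = q ^ n) (A : ℕ → E)
    (hF : ∀ x : Eˣ, (∑ e : ZMod n × ZMod n,
      coefA q A e * (x : E) ^ ((q : ℤ) ^ e.1.val - (q : ℤ) ^ e.2.val)) = 1) : False := by
  classical
  have h0 : ∑ x : Eˣ, (∑ e : ZMod n × ZMod n,
      coefA q A e * (x : E) ^ ((q : ℤ) ^ e.1.val - (q : ℤ) ^ e.2.val)) = -1 := by
    have := sumz (E := E) 0
    simp only [zpow_zero, dvd_zero, if_true] at this
    simp only [hF, this]
  rw [Finset.sum_comm] at h0
  simp only [← Finset.mul_sum, sumz] at h0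
  have hlt : ∀ l k : ZMod n, l.val < k.val → ¬ ((q : ℤ) ^ n - 1) ∣ (q : ℤ) ^ k.val - (q : ℤ) ^ l.val := by
    intro l k hlk hd
    have hk := ZMod.val_lt k
    have h1 : q ^ l.val < q ^ k.val := Nat.pow_lt_pow_right hq2 hlk
    have h2 : q ^ k.val < q ^ n := Nat.pow_lt_pow_right hq2 hk
    have h3 : 1 ≤ q ^ l.val := Nat.one_le_pow _ _ (by omega)
    zify at h1 h2 h3
    have := Int.le_of_dvd (by linarith) hd
    linarith
  rw [Finset.sum_eq_zero] at h0
  · simp at h0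
  · rintro ⟨l, k⟩ -
    by_cases hlk : l = k
    · simp [coefA, hlk]
    · rw [if_neg, mul_zero]
      rw [hE]; push_cast
      rcases lt_or_gt_of_ne (fun h => hlk (ZMod.val_injective n h) : l.val ≠ k.val) with h | h
      · rw [← dvd_neg, neg_sub]; exact hlt l k h
      · exact hlt k l h

lemma sum_mono {E : Type*} [Field E] [Fintype E] [DecidableEq E] (N : ℕ) (hN : Fintype.card E - 1 = N) (b : E) (s t : ℕ)
    (h : ¬ N ∣ s * t) : ∑ x : Eˣ, (b * (x : E) ^ s) ^ t = 0 := by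
  have := FiniteField.sum_pow_units E (s * t)
  rw [hN, if_neg h] at this
  push_cast at this
  simp only [mul_pow, ← pow_mul, ← Finset.mul_sum, this, mul_zero]

lemma sum_one_units {E : Type*} [Field E] [Fintype E] [DecidableEq E] : ∑ x : Eˣ, (1 : E) = -1 := by
  have := sumz (E := E) 0
  simpa using this

lemma q3_contra {E : Type*} [Field E] [Fintype E] (hE : Fintype.card E = 27)
    (b : E) (s : ℕ) (hs : s = 2 ∨ s = 8)
    (hF : ∀ x : Eˣ, (b * (x : E) ^ s + (b * (x : E) ^ s) ^ 3 + (b * (x : E) ^ s) ^ 9) ^ 2 = 1) : False := by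
  classical
  have h1 := sum_one_units (E := E)
  rw [← Finset.sum_congr rfl (fun x _ => hF x)] at h1
  have e : ∀ z : E, (z + z ^ 3 + z ^ 9) ^ 2 = z ^ 2 + z ^ 6 + z ^ 18 + 2 * z ^ 4 + 2 * z ^ 10 + 2 * z ^ 12 := by
    intro z; ring
  have hz : ∀ t, ¬ 13 ∣ t → ∑ x : Eˣ, (b * (x : E) ^ s) ^ t = 0 := by
    intro t ht
    apply sum_mono 26 (by rw [hE])
    rcases hs with rfl | rfl <;> omega
  simp only [e, Finset.sum_add_distrib, ← Finset.mul_sum] at h1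
  rw [hz 2 (by norm_num), hz 6 (by norm_num), hz 18 (by norm_num), hz 4 (by norm_num),
    hz 10 (by norm_num), hz 12 (by norm_num)] at h1
  simp at h1

lemma q4_contra {E : Type*} [Field E] [Fintype E] [CharP E 2] (hE : Fintype.card E = 64)
    (b : E) (s : ℕ) (hs : s = 3 ∨ s = 15)
    (hF : ∀ x : Eˣ, (b * (x : E) ^ s + (b * (x : E) ^ s) ^ 4 + (b * (x : E) ^ s) ^ 16) ^ 3 = 1) : False := by
  classical
  have h1 := sum_one_units (E := E)
  rw [← Finset.sum_congr rfl (fun x _ => hF x)] at h1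
  have e : ∀ z : E, (z + z ^ 4 + z ^ 16) ^ 3 = z ^ 3 + z ^ 9 + z ^ 33 + z ^ 6 + z ^ 12 + z ^ 36 + z ^ 18
      + z ^ 24 + z ^ 48 := by
    intro z
    have h2 : (2 : E) = 0 := by exact_mod_cast CharP.cast_eq_zero E 2
    linear_combination (z * z ^ 4 * (z + z ^ 4 + z ^ 16) + z * z ^ 16 * (z + z ^ 4 + z ^ 16) + z ^ 4 * z ^ 16 * (z + z ^ 4 + z ^ 16)) * h2
  have hz : ∀ t, ¬ 21 ∣ t → ∑ x : Eˣ, (b * (x : E) ^ s) ^ t = 0 := by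
    intro t ht
    apply sum_mono 63 (by rw [hE])
    rcases hs with rfl | rfl <;> omega
  simp only [e, Finset.sum_add_distrib] at h1
  rw [hz 3 (by norm_num), hz 9 (by norm_num), hz 33 (by norm_num), hz 6 (by norm_num),
    hz 12 (by norm_num), hz 36 (by norm_num), hz 18 (by norm_num), hz 24 (by norm_num), hz 48 (by norm_num)] at h1
  simp at h1

lemma n3_red {E : Type*} [Field E] [Fintype E] (p m q : ℕ) [Fact p.Prime] [CharP E p]
    (hq : q = p ^ m) (a : ℕ → E)
    (hTr : ∑ j ∈ Finset.range 3, (a 0) ^ q ^ j = 0) (h12 : a 1 = 0 ∨ a 2 = 0) :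
    ∃ (b : E) (s : ℕ), (s = q - 1 ∨ s = q ^ 2 - 1) ∧ ∀ x : Eˣ,
      ∑ j ∈ Finset.range 3, ((∑ i ∈ Finset.range 3, a i * (x : E) ^ q ^ i) / (x : E)) ^ q ^ j =
      b * (x : E) ^ s + (b * (x : E) ^ s) ^ q + (b * (x : E) ^ s) ^ q ^ 2 := by
  have hqpos : 0 < q := hq ▸ pow_pos (Nat.Prime.pos Fact.out) _
  have key : ∀ (z x : E), x ≠ 0 → (∑ i ∈ Finset.range 3, a i * (x : E) ^ q ^ i) / (x : E) = a 0 + z →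
      ∑ j ∈ Finset.range 3, ((∑ i ∈ Finset.range 3, a i * (x : E) ^ q ^ i) / (x : E)) ^ q ^ j =
      z + z ^ q + z ^ q ^ 2 := by
    intro z x hx h
    rw [h]
    have : ∀ j, (a 0 + z) ^ q ^ j = a 0 ^ q ^ j + z ^ q ^ j := by
      intro j
      have hqj : q ^ j = p ^ (m * j) := by rw [hq, pow_mul]
      rw [hqj, add_pow_char_pow]
    simp only [this, Finset.sum_add_distrib, hTr]
    simp [Finset.sum_range_succ]
  rcases h12 with h | h
  · refine ⟨a 2, q ^ 2 - 1, Or.inr rfl, fun x => key _ _ x.ne_zero ?_⟩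
    have e : (x : E) ^ q ^ 2 = (x : E) ^ (q ^ 2 - 1) * x := by
      rw [← pow_succ, Nat.sub_add_cancel (Nat.one_le_pow _ _ hqpos)]
    simp only [Finset.sum_range_succ, h, e]
    field_simp
    simp
    ring
  · refine ⟨a 1, q - 1, Or.inl rfl, fun x => key _ _ x.ne_zero ?_⟩
    have e : (x : E) ^ q = (x : E) ^ (q - 1) * x := by
      rw [← pow_succ, Nat.sub_add_cancel hqpos]
    simp only [Finset.sum_range_succ, h, pow_one, e]
    field_simp
    simp
    ring

lemma lead_spec (p N r : ℕ) : ∃ u : ℕ, leadFn p N (r % N) ≡ r * p ^ u [MOD N] := by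
  have hne : {k : ℕ | ∃ u : ℕ, k % N = (r % N) * p ^ u % N}.Nonempty := ⟨r, 0, by simp⟩
  obtain ⟨u, hu⟩ := Nat.sInf_mem hne
  refine ⟨u, ?_⟩
  change leadFn p N (r % N) % N = _ at hu
  refine Nat.ModEq.trans (b := (r % N) * p ^ u) hu ?_
  exact (Nat.mod_modEq r N).mul_right _

lemma lead_ge (p m q n i j : ℕ) (hp : p.Prime) (hm : 1 ≤ m) (hq : q = p ^ m) (hi1 : 1 ≤ i) (hin : i < n)
    (hj : Nat.gcd j (q ^ n - 1) = 1) :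
    q - 1 ≤ leadFn p (q ^ n - 1) (j * (q ^ i - 1) % (q ^ n - 1)) := by
  obtain ⟨u, hu⟩ := lead_spec p (q ^ n - 1) (j * (q ^ i - 1))
  set e := leadFn p (q ^ n - 1) (j * (q ^ i - 1) % (q ^ n - 1)) with he
  have hq2 : 2 ≤ q := by rw [hq]; exact hp.two_le.trans (Nat.le_self_pow (by omega) p)
  have h1 : q ^ i < q ^ n := Nat.pow_lt_pow_right hq2 hin
  have h2 : q ^ 1 ≤ q ^ i := Nat.pow_le_pow_right (by omega) hi1
  rw [pow_one] at h2
  have hcop : Nat.Coprime (q ^ n - 1) p := by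
    have : Nat.Coprime (q ^ n - 1) (q ^ n) := by
      have := Nat.coprime_self_add_right (m := q ^ n - 1) (n := 1)
      rw [Nat.sub_add_cancel (by omega)] at this
      simpa using this
    refine Nat.Coprime.coprime_dvd_right ?_ this
    rw [hq, ← pow_mul]
    exact dvd_pow_self p (Nat.mul_pos (by omega) (by omega)).ne'
  have hdv : (q - 1) ∣ e := by
    have d1 : (q - 1) ∣ q ^ n - 1 := by simpa using Nat.sub_dvd_pow_sub_pow q 1 n
    have d2 : (q - 1) ∣ q ^ i - 1 := by simpa using Nat.sub_dvd_pow_sub_pow q 1 i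
    exact (hu.dvd_iff d1).2 ((d2.mul_left _).mul_right _)
  apply Nat.le_of_dvd _ hdv
  rcases Nat.eq_zero_or_pos e with h0 | h0
  · exfalso
    rw [h0] at hu
    have h3 : q ^ n - 1 ∣ j * (q ^ i - 1) * p ^ u := (Nat.modEq_zero_iff_dvd).1 hu.symm
    have h4 := (hcop.pow_right u).dvd_of_dvd_mul_right h3
    have h5 := (Nat.Coprime.symm hj).dvd_of_dvd_mul_left h4
    have := Nat.le_of_dvd (by omega) h5
    omega
  · exact h0

noncomputable def DD (q n : ℕ) : ℕ := ⌈2 * ((q : ℝ) ^ n - (q : ℝ)) /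
            (((q : ℝ) - 1) * (⌊2 * Real.sqrt ((q : ℝ) ^ n)⌋₊ : ℝ))⌉₊

lemma DD_bound (q n P : ℕ) (hq : 3 ≤ q) (hn : 3 ≤ n) (hP : P ^ 2 ≤ q ^ n) :
    DD q n * (P + 1) < q ^ n - 1 := by
  have hQ : 27 ≤ q ^ n := calc
    27 = 3 ^ 3 := by norm_num
    _ ≤ q ^ 3 := Nat.pow_le_pow_left hq 3
    _ ≤ q ^ n := Nat.pow_le_pow_right (by omega) hn
  have hqQ : q ≤ q ^ n := Nat.le_self_pow (by omega) q
  have hq' : (3 : ℝ) ≤ q := by exact_mod_cast hq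
  have hqQ' : (q : ℝ) ≤ (q : ℝ) ^ n := by exact_mod_cast hqQ
  have hQ' : (27 : ℝ) ≤ (q : ℝ) ^ n := by exact_mod_cast hQ
  have hP' : (P : ℝ) ^ 2 ≤ (q : ℝ) ^ n := by exact_mod_cast hP
  have hgoal : (DD q n : ℝ) * (P + 1) < (q : ℝ) ^ n - 1 → DD q n * (P + 1) < q ^ n - 1 := by
    intro h
    have : DD q n * (P + 1) + 1 < q ^ n := by
      have : (DD q n : ℝ) * (P + 1) + 1 < (q : ℝ) ^ n := by linarith
      exact_mod_cast this
    omega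
  apply hgoal
  set Q : ℝ := (q : ℝ) ^ n with hQd
  have hs0 : 0 ≤ Real.sqrt Q := Real.sqrt_nonneg _
  have hss : Real.sqrt Q * Real.sqrt Q = Q := Real.mul_self_sqrt (by linarith)
  have hs5 : (5.1 : ℝ) ≤ Real.sqrt Q := Real.le_sqrt_of_sq_le (by norm_num; linarith)
  set Rn : ℕ := ⌊2 * Real.sqrt Q⌋₊ with hRn
  have hR10 : (10 : ℝ) ≤ (Rn : ℝ) := by
    have : 10 ≤ Rn := Nat.le_floor (by push_cast; linarith)
    exact_mod_cast this
  have hRs : (Rn : ℝ) ≤ 2 * Real.sqrt Q := Nat.floor_le (by positivity)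
  have hPs : (P : ℝ) ≤ Real.sqrt Q := Real.le_sqrt_of_sq_le hP'
  have hPR : 2 * (P : ℝ) ≤ Rn := by
    have : 2 * P ≤ Rn := Nat.le_floor (by push_cast; linarith)
    exact_mod_cast this
  set X : ℝ := 2 * (Q - q) / (((q : ℝ) - 1) * (Rn : ℝ)) with hX
  have hX0 : 0 ≤ X := by
    apply div_nonneg
    · linarith
    · apply mul_nonneg <;> linarith
  have hXR : X * Rn ≤ Q := by
    have h1 : X * (((q : ℝ) - 1) * (Rn : ℝ)) = 2 * (Q - q) := by
      rw [hX]; apply div_mul_cancel₀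
      apply ne_of_gt
      apply mul_pos <;> linarith
    have h2 : 0 ≤ X * Rn := mul_nonneg hX0 (by linarith)
    nlinarith
  have hD : (DD q n : ℝ) ≤ X + 1 := by
    have := Nat.ceil_lt_add_one hX0
    exact this.le
  have hX10 : X * 10 ≤ Q := le_trans (mul_le_mul_of_nonneg_left hR10 hX0) hXR
  have hsQ : 5 * Real.sqrt Q ≤ Q := by nlinarith
  calc (DD q n : ℝ) * (P + 1) ≤ (X + 1) * ((Rn : ℝ) / 2 + 1) := by
        apply mul_le_mul hD (by linarith) (by positivity) (by linarith)
    _ = X * Rn / 2 + X + Rn / 2 + 1 := by ring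
    _ < Q - 1 := by linarith

lemma DD_two (q : ℕ) (hq : 2 ≤ q) : DD q 2 ≤ 1 := by
  have hq' : (2 : ℝ) ≤ q := by exact_mod_cast hq
  apply Nat.ceil_le.2
  have : (⌊2 * Real.sqrt ((q : ℝ) ^ 2)⌋₊ : ℝ) = 2 * q := by
    rw [Real.sqrt_sq (by linarith)]
    have : (2 * (q : ℝ)) = ((2 * q : ℕ) : ℝ) := by push_cast; ring
    rw [this, Nat.floor_natCast]
  rw [this, div_le_iff₀ (by apply mul_pos <;> linarith)]
  push_cast
  nlinarith

lemma DD_three (q : ℕ) (hq : 5 ≤ q) : DD q 3 ≤ q - 2 := by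
  have hq' : (5 : ℝ) ≤ q := by exact_mod_cast hq
  apply Nat.ceil_le.2
  have hs : 2 * (q : ℝ) ≤ Real.sqrt ((q : ℝ) ^ 3) := Real.le_sqrt_of_sq_le (by nlinarith [sq_nonneg (q : ℝ)])
  have hR : 4 * (q : ℝ) ≤ (⌊2 * Real.sqrt ((q : ℝ) ^ 3)⌋₊ : ℝ) := by
    have : 4 * q ≤ ⌊2 * Real.sqrt ((q : ℝ) ^ 3)⌋₊ := Nat.le_floor (by push_cast; linarith)
    exact_mod_cast this
  rw [Nat.cast_sub (by omega), div_le_iff₀ (by apply mul_pos <;> linarith)]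
  push_cast
  have h1 : ((q : ℝ) - 2) * ((q - 1) * (4 * q)) ≤ ((q : ℝ) - 2) * ((q - 1) * (⌊2 * Real.sqrt ((q : ℝ) ^ 3)⌋₊ : ℝ)) := by
    apply mul_le_mul_of_nonneg_left _ (by linarith)
    exact mul_le_mul_of_nonneg_left hR (by linarith)
  refine le_trans ?_ h1
  have : 0 ≤ ((q : ℝ) - 1) * q * (2 * (q - 5)) := by
    apply mul_nonneg (mul_nonneg (by linarith) (by linarith)) (by linarith)
  nlinarith

lemma lead_anti (p m q n i j : ℕ) (hp : p.Prime) (hm : 1 ≤ m) (hq : q = p ^ m) (hq3 : 3 ≤ q)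
    (hn : 3 ≤ n) (hi1 : 1 ≤ i) (hin : i < n)
    (hj : Nat.gcd j (q ^ n - 1) = 1)
    (h1 : leadFn p (q ^ n - 1) (j * (q ^ i - 1) % (q ^ n - 1)) ≤ DD q n)
    (h2 : leadFn p (q ^ n - 1) (j * (q ^ (n - i) - 1) % (q ^ n - 1)) ≤ DD q n) : False := by
  have g1 := lead_ge p m q n i j hp hm hq hi1 hin hj
  obtain ⟨u, hu⟩ := lead_spec p (q ^ n - 1) (j * (q ^ i - 1))
  obtain ⟨v, hv⟩ := lead_spec p (q ^ n - 1) (j * (q ^ (n - i) - 1))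
  set e := leadFn p (q ^ n - 1) (j * (q ^ i - 1) % (q ^ n - 1)) with he
  set e' := leadFn p (q ^ n - 1) (j * (q ^ (n - i) - 1) % (q ^ n - 1)) with he'
  clear_value e e'
  have hQpos : 1 ≤ q ^ n := Nat.one_le_pow _ _ (by omega)
  have hQp : q ^ n = p ^ (m * n) := by rw [hq, pow_mul]
  have hmn : 0 < m * n := by apply Nat.mul_pos <;> omega
  rw [Nat.modEq_iff_dvd, dvd_sub_comm] at hu hv
  have c1 : ((q ^ n - 1 : ℕ) : ℤ) = (q : ℤ) ^ n - 1 := by push_cast [hQpos]; rfl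
  have c2 : ((q ^ i - 1 : ℕ) : ℤ) = (q : ℤ) ^ i - 1 := by
    push_cast [Nat.one_le_pow i q (by omega)]; rfl
  have c3 : ((q ^ (n - i) - 1 : ℕ) : ℤ) = (q : ℤ) ^ (n - i) - 1 := by
    push_cast [Nat.one_le_pow (n - i) q (by omega)]; rfl
  rw [c1] at hu hv
  push_cast [c2, c3] at hu hv
  set N : ℤ := (q : ℤ) ^ n - 1 with hN
  have hper : ∀ t : ℕ, N ∣ ((p : ℤ) ^ (m * n)) ^ t - 1 := by
    intro t
    have : ((p : ℤ) ^ (m * n)) = (q : ℤ) ^ n := by exact_mod_cast hQp.symm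
    rw [this]
    simpa using sub_dvd_pow_sub_pow ((q : ℤ) ^ n) 1 t
  have hqq : (q : ℤ) ^ (n - i) * (q : ℤ) ^ i = N + 1 := by
    rw [← pow_add, Nat.sub_add_cancel hin.le, hN]; ring
  have hqi : (q : ℤ) ^ i = (p : ℤ) ^ (m * i) := by rw [hq]; push_cast; rw [pow_mul]
  -- relation
  have r1 : N ∣ (e' : ℤ) * (p : ℤ) ^ (m * i + u) + e * (p : ℤ) ^ v := by
    obtain ⟨s, hs⟩ := hu
    obtain ⟨t, ht⟩ := hv
    refine ⟨t * (p : ℤ) ^ (m * i + u) + s * (p : ℤ) ^ v + j * (p : ℤ) ^ v * (p : ℤ) ^ u, ?_⟩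
    rw [pow_add, ← hqi]
    linear_combination ((q : ℤ) ^ i * (p : ℤ) ^ u) * ht + (p : ℤ) ^ v * hs + j * (p : ℤ) ^ v * (p : ℤ) ^ u * hqq
  obtain ⟨r, hr, r2⟩ : ∃ r, r < m * n ∧ N ∣ (e' : ℤ) * (p : ℤ) ^ r + e := by
    set w := m * n * v - v with hw
    have hvw : v + w = m * n * v := by
      have : v ≤ m * n * v := Nat.le_mul_of_pos_left v hmn
      omega
    refine ⟨(m * i + u + w) % (m * n), Nat.mod_lt _ hmn, ?_⟩
    obtain ⟨s, hs⟩ := hper v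
    obtain ⟨t, ht⟩ := hper ((m * i + u + w) / (m * n))
    obtain ⟨k, hk⟩ := r1
    have e1 : (p : ℤ) ^ v * (p : ℤ) ^ w = ((p : ℤ) ^ (m * n)) ^ v := by
      rw [← pow_add, hvw, pow_mul]
    have e2 : (p : ℤ) ^ (m * i + u) * (p : ℤ) ^ w =
        ((p : ℤ) ^ (m * n)) ^ ((m * i + u + w) / (m * n)) * (p : ℤ) ^ ((m * i + u + w) % (m * n)) := by
      rw [← pow_add, ← pow_mul, ← pow_add, Nat.div_add_mod]
    refine ⟨k * (p : ℤ) ^ w - e * s - e' * t * (p : ℤ) ^ ((m * i + u + w) % (m * n)), ?_⟩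
    linear_combination (p : ℤ) ^ w * hk - e' * e2 - e * e1 - e * hs - e' * (p : ℤ) ^ ((m * i + u + w) % (m * n)) * ht
  have hepos : 0 < e := by omega
  have fin : ∀ P x y : ℕ, P ^ 2 ≤ q ^ n → x ≤ DD q n → y ≤ DD q n → 0 < x * P + y →
      N ∣ (x : ℤ) * (P : ℤ) + y → False := by
    intro P x y hP hx hy hpos hd
    have hb := DD_bound q n P hq3 hn hP
    have h3 : q ^ n - 1 ∣ x * P + y := by
      rw [← c1] at hd; exact_mod_cast hd
    have h4 := Nat.le_of_dvd hpos h3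
    have h5 : x * P ≤ DD q n * P := Nat.mul_le_mul_right _ hx
    have h6 : DD q n * (P + 1) = DD q n * P + DD q n := by ring
    omega
  by_cases hc : (p ^ r) ^ 2 ≤ q ^ n
  · exact fin (p ^ r) e' e hc h2 h1 (by omega) (by push_cast; exact r2)
  · have hP2 : (p ^ (m * n - r)) ^ 2 ≤ q ^ n := by
      by_contra hc2
      have hm1 : p ^ (m * n - r) * p ^ r = q ^ n := by
        rw [← pow_add, Nat.sub_add_cancel hr.le, hQp]
      push Not at hc hc2
      have h3 := Nat.mul_lt_mul'' hc2 hc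
      have h4 : (p ^ (m * n - r)) ^ 2 * (p ^ r) ^ 2 = q ^ n * q ^ n := by
        rw [← mul_pow (p ^ (m * n - r)), hm1, sq]
      rw [h4] at h3
      exact lt_irrefl _ h3
    have hpp : 0 < p ^ (m * n - r) := pow_pos hp.pos _
    refine fin (p ^ (m * n - r)) e e' hP2 h1 h2 (by positivity) ?_
    obtain ⟨k, hk⟩ := r2
    have hm1 : (p : ℤ) ^ (m * n - r) * (p : ℤ) ^ r = N + 1 := by
      rw [← pow_add, Nat.sub_add_cancel hr.le, hN]
      have : ((p : ℤ) ^ (m * n)) = (q : ℤ) ^ n := by exact_mod_cast hQp.symm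
      rw [this]; ring
    refine ⟨k * (p : ℤ) ^ (m * n - r) - e', ?_⟩
    push_cast
    linear_combination (p : ℤ) ^ (m * n - r) * hk - e' * hm1

/-- Statement 16 (corollary of Hasse–Weil–Serre, case `Tr(a_0) = 0`): if
`Tr_{q^n/q}(L(x)/x) ≠ 0` for all nonzero `x` then for every `1 ≤ j ≤ q^n−2` coprime to
`q^n−1` there is `1 ≤ i ≤ n−1` with `a_i ≠ 0` and
`Lead(Res(j(q^i−1))) ≥ 1 + ⌈2(q^n−q)/((q−1)⌊2q^{n/2}⌋)⌉`. -/
theorem stmt_17 (p m q n : ℕ) (hp : p.Prime) (hm : 1 ≤ m) (hq : q = p ^ m) (hn : 1 ≤ n)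
    (E : Type*) [Field E] [Fintype E] (hE : Fintype.card E = q ^ n)
    (a : ℕ → E) (ha : ∃ i : ℕ, 1 ≤ i ∧ i ≤ n - 1 ∧ a i ≠ 0)
    (h : ∀ x : E, x ≠ 0 →
      ∑ j ∈ Finset.range n, ((∑ i ∈ Finset.range n, a i * x ^ q ^ i) / x) ^ q ^ j ≠ 0)
    (hTr : ∑ j ∈ Finset.range n, (a 0) ^ q ^ j = 0) :
    ∀ j : ℕ, 1 ≤ j → j ≤ q ^ n - 2 → Nat.gcd j (q ^ n - 1) = 1 →
      ∃ i : ℕ, 1 ≤ i ∧ i ≤ n - 1 ∧ a i ≠ 0 ∧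
        1 + ⌈2 * ((q : ℝ) ^ n - (q : ℝ)) /
            (((q : ℝ) - 1) * (⌊2 * Real.sqrt ((q : ℝ) ^ n)⌋₊ : ℝ))⌉₊
          ≤ leadFn p (q ^ n - 1) (j * (q ^ i - 1) % (q ^ n - 1)) := by
  intro j hj1 hj2 hj
  by_contra hcon
  push Not at hcon
  obtain ⟨i0, hi1, hin, hai⟩ := ha
  have hn2 : 2 ≤ n := by omega
  have hq2 : 2 ≤ q := by rw [hq]; exact hp.two_le.trans (Nat.le_self_pow (by omega) p)
  have hlead : ∀ i, 1 ≤ i → i ≤ n - 1 → a i ≠ 0 →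
      leadFn p (q ^ n - 1) (j * (q ^ i - 1) % (q ^ n - 1)) ≤ DD q n := by
    intro i h1 h2 h3
    have := hcon i h1 h2 h3
    unfold DD
    omega
  have : Fact p.Prime := ⟨hp⟩
  have : NeZero n := ⟨by omega⟩
  have hchar : CharP E p := by
    obtain ⟨p', hp'⟩ := CharP.exists E
    obtain ⟨k, hpp', hk⟩ := FiniteField.card E p'
    rw [hE, hq, ← pow_mul] at hk
    have hd : p ∣ p' ^ (k : ℕ) := by
      rw [← hk]; exact dvd_pow_self p (Nat.mul_pos (by omega) (by omega)).ne'
    have := (Nat.prime_dvd_prime_iff_eq hp hpp').1 (hp.dvd_of_dvd_pow hd)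
    rw [this]; exact hp'
  have hF0 : ∀ x : Eˣ, (∑ j ∈ Finset.range n,
      ((∑ i ∈ Finset.range n, a i * (x : E) ^ q ^ i) / (x : E)) ^ q ^ j) ^ (q - 1) = 1 := fun x =>
    trace_pow p m q n hq hE _ (h x x.ne_zero)
  have hF : ∀ x : Eˣ, (∑ e : ZMod n × ZMod n,
      coefA q a e * (x : E) ^ ((q : ℤ) ^ e.1.val - (q : ℤ) ^ e.2.val)) ^ (q - 1) = 1 := fun x => by
    rw [← trace_expand p m q n hq hE a hTr x]; exact hF0 x
  by_cases hq3 : q = 2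
  · refine q2_contra q n hq2 hE a fun x => ?_
    have := hF x
    have e : q - 1 = 1 := by omega
    rwa [e, pow_one] at this
  have hq3 : 3 ≤ q := by omega
  have hge := lead_ge p m q n i0 j hp hm hq hi1 (by omega) hj
  have hle := hlead i0 hi1 hin hai
  by_cases hn3 : n = 2
  · subst hn3
    have := DD_two q hq2
    omega
  have hn3 : 3 ≤ n := by omega
  have hanti : ∀ i, 1 ≤ i → i < n → a i ≠ 0 → a (n - i) = 0 := by
    intro i h1 h2 h3
    by_contra h4
    exact lead_anti p m q n i j hp hm hq hq3 hn3 h1 h2 hj (hlead i h1 (by omega) h3)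
      (hlead (n - i) (by omega) (by omega) h4)
  by_cases hn4 : n = 3
  · subst hn4
    by_cases hq5 : 5 ≤ q
    · have := DD_three q hq5
      omega
    have h12 : a 1 = 0 ∨ a 2 = 0 := by
      by_cases h1 : a 1 = 0
      · exact Or.inl h1
      · exact Or.inr (hanti 1 (by norm_num) (by norm_num) h1)
    obtain ⟨b, s, hs, hb⟩ := n3_red p m q hq a hTr h12
    have hF1 : ∀ x : Eˣ, (b * (x : E) ^ s + (b * (x : E) ^ s) ^ q + (b * (x : E) ^ s) ^ q ^ 2) ^ (q - 1) = 1 :=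
      fun x => by rw [← hb x]; exact hF0 x
    have hq34 : q = 3 ∨ q = 4 := by omega
    rcases hq34 with h3 | h4
    · rw [h3] at hF1 hs hE
      exact q3_contra (by rw [hE]; norm_num) b s (by simpa using hs) (by simpa using hF1)
    · have hp2 : p = 2 := by
        have hd : p ∣ 2 ^ 2 := by
          have : p ∣ q := by rw [hq]; exact dvd_pow_self p (by omega)
          rw [h4] at this; simpa using this
        exact (Nat.prime_dvd_prime_iff_eq hp Nat.prime_two).1 (hp.dvd_of_dvd_pow hd)
      rw [hp2] at hchar
      rw [h4] at hF1 hs hE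
      exact q4_contra (by rw [hE]; norm_num) b s (by simpa using hs) (by simpa using hF1)
  · have hval : ((i0 : ℕ) : ZMod n).val = i0 := ZMod.val_cast_of_lt (by omega)
    refine main_case p m q n hq hq3 (by omega) hE a hF (i0 : ZMod n) ?_ (by rw [hval]; exact hai) ?_
    · intro h0
      rw [h0, ZMod.val_zero] at hval
      omega
    · intro i hi h1
      have hv : i.val ≠ 0 := fun h => hi ((ZMod.val_eq_zero i).1 h)
      rw [ZMod.neg_val, if_neg hi]
      exact hanti _ (by omega) (ZMod.val_lt i) h1
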